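/- Let s₀ > 0, α ∈ (−π/2, π/2), η′ > 0, and n ≥ 1 an integer. Define f(x) := (cos α / (s₀(1+sin α))) · cos(α−x) / (2(1−sin(α−x))) and G_n(τ) := ∫₀^{ε′} (2 sin(x/2))^{n−1/2} · e^{i(n−1/2)(α−x/2)} / (4 sin²((π/2 − α + x)/2)) · e^{τ f(x)} dx, where 0 < ε′ < π/2 − α. Then lim_{τ→∞} τ^{n+1/2} · e^{−τ/(2s₀)} · G_n(τ) = e^{i(n−1/2)α} · (2 s₀ cos α)^{n+1/2} · Γ(n+1/2) / (2(1−sin α)). -/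

import Mathlib

open Real Filter MeasureTheory

open Set Topology

/-- Watson's lemma at leading order, for an amplitude `A x ~ a * x ^ p` and a phase `φ x ~ -k * x`
at the left endpoint `0`. -/
theorem tendsto_rpow_mul_integral_mul_exp {p ε M c k : ℝ} {A : ℝ → ℂ} {φ : ℝ → ℝ} {a : ℂ}
    (hp : -1 < p) (hε : 0 < ε) (hc : 0 < c) (hk : 0 < k)
    (hA : Measurable A) (hφ : Measurable φ)
    (hAM : ∀ x ∈ Ioo 0 ε, ‖A x‖ ≤ M * x ^ p)
    (hA0 : Tendsto (fun x => A x / ((x ^ p : ℝ) : ℂ)) (𝓝[>] 0) (𝓝 a))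
    (hφc : ∀ x ∈ Ioo 0 ε, φ x ≤ -(c * x))
    (hφ0 : Tendsto (fun x => φ x / x) (𝓝[>] 0) (𝓝 (-k))) :
    Tendsto (fun τ : ℝ => ((τ ^ (p + 1) : ℝ) : ℂ) *
        ∫ x in Ioo 0 ε, A x * ((Real.exp (τ * φ x) : ℝ) : ℂ)) atTop
      (𝓝 (a * (((1 / k) ^ (p + 1) * Real.Gamma (p + 1) : ℝ) : ℂ))) := by
  set g : ℝ → ℝ → ℂ := fun τ =>
    (Iio ε).indicator fun x => A x * ((Real.exp (τ * φ x) : ℝ) : ℂ) with hg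
  have hscale : ∀ᶠ τ : ℝ in atTop,
      ∫ u in Ioi 0, ((τ ^ p : ℝ) : ℂ) * g τ (τ⁻¹ * u) =
        ((τ ^ (p + 1) : ℝ) : ℂ) * ∫ x in Ioo 0 ε, A x * ((Real.exp (τ * φ x) : ℝ) : ℂ) := by
    filter_upwards [eventually_gt_atTop 0] with τ hτ
    rw [integral_const_mul, integral_comp_mul_left_Ioi _ _ (inv_pos.2 hτ), mul_zero, hg,
      setIntegral_indicator measurableSet_Iio, Ioi_inter_Iio, inv_inv, Complex.real_smul,
      Real.rpow_add_one hτ.ne']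
    push_cast
    ring
  have hlim : ∫ u in Ioi 0, a * ((u ^ p * Real.exp (-(k * u)) : ℝ) : ℂ) =
      a * (((1 / k) ^ (p + 1) * Real.Gamma (p + 1) : ℝ) : ℂ) := by
    have h := Real.integral_rpow_mul_exp_neg_mul_Ioi (a := p + 1) (by linarith) hk
    rw [add_sub_cancel_right] at h
    rw [integral_const_mul, integral_complex_ofReal, h]
  rw [← hlim]
  refine Tendsto.congr' hscale ?_
  refine tendsto_integral_filter_of_dominated_convergence
    (fun u => M * (u ^ p * Real.exp (-c * u))) ?_ ?_ ?_ ?_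
  · refine Eventually.of_forall fun τ => Measurable.aestronglyMeasurable ?_
    have : Measurable (g τ) := Measurable.indicator (by fun_prop) measurableSet_Iio
    fun_prop
  · filter_upwards [eventually_gt_atTop 0] with τ hτ
    refine (ae_restrict_iff' measurableSet_Ioi).2 (Eventually.of_forall fun u hu => ?_)
    have hu : 0 < u := hu
    have hx : 0 < τ⁻¹ * u := by positivity
    have hM : 0 ≤ M := by
      have h := (norm_nonneg _).trans (hAM (ε / 2) ⟨by linarith, by linarith⟩)
      exact nonneg_of_mul_nonneg_left h (by positivity)
    by_cases hxε : τ⁻¹ * u < ε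
    · have hux : τ ^ p * (τ⁻¹ * u) ^ p = u ^ p := by
        rw [← Real.mul_rpow hτ.le hx.le, mul_inv_cancel_left₀ hτ.ne']
      have hexp : τ * φ (τ⁻¹ * u) ≤ -c * u := by
        have h := mul_le_mul_of_nonneg_left (hφc _ ⟨hx, hxε⟩) hτ.le
        have h' : τ * -(c * (τ⁻¹ * u)) = -c * u := by field_simp
        linarith
      rw [hg]
      simp only [indicator_of_mem (mem_Iio.2 hxε), norm_mul, Complex.norm_real, Real.norm_eq_abs,
        Real.abs_exp, abs_of_pos (Real.rpow_pos_of_pos hτ p)]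
      calc τ ^ p * (‖A (τ⁻¹ * u)‖ * Real.exp (τ * φ (τ⁻¹ * u)))
          ≤ τ ^ p * ((M * (τ⁻¹ * u) ^ p) * Real.exp (-c * u)) := by
            gcongr
            exact hAM _ ⟨hx, hxε⟩
        _ = M * (τ ^ p * (τ⁻¹ * u) ^ p * Real.exp (-c * u)) := by ring
        _ = _ := by rw [hux]
    · rw [hg]
      simp only [indicator_of_notMem (notMem_Iio.2 (not_lt.1 hxε)), mul_zero, norm_zero]
      positivity
  · refine Integrable.const_mul ?_ M
    simpa [IntegrableOn] using integrableOn_rpow_mul_exp_neg_mul_rpow hp one_pos hc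
  · refine (ae_restrict_iff' measurableSet_Ioi).2 (Eventually.of_forall fun u hu => ?_)
    have hu : 0 < u := hu
    have hx : Tendsto (fun τ : ℝ => τ⁻¹ * u) atTop (𝓝[>] 0) := by
      refine tendsto_nhdsWithin_iff.2 ⟨?_, ?_⟩
      · simpa using tendsto_inv_atTop_zero.mul_const u
      · filter_upwards [eventually_gt_atTop 0] with τ hτ
        exact mul_pos (inv_pos.2 hτ) hu
    have hexp : Tendsto (fun τ : ℝ => ((Real.exp (φ (τ⁻¹ * u) / (τ⁻¹ * u) * u) : ℝ) : ℂ)) atTop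
        (𝓝 ((Real.exp (-k * u) : ℝ) : ℂ)) :=
      (Complex.continuous_ofReal.tendsto _).comp
        ((Real.continuous_exp.tendsto _).comp ((hφ0.comp hx).mul_const u))
    have h := ((hA0.comp hx).mul_const ((u ^ p : ℝ) : ℂ)).mul hexp
    have heq : a * ((u ^ p : ℝ) : ℂ) * ((Real.exp (-k * u) : ℝ) : ℂ) =
        a * ((u ^ p * Real.exp (-(k * u)) : ℝ) : ℂ) := by
      rw [neg_mul]; push_cast; ring
    rw [heq] at h
    refine h.congr' ?_
    filter_upwards [eventually_gt_atTop 0, hx.eventually (eventually_nhdsWithin_of_eventually_nhds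
      (eventually_lt_nhds hε))] with τ hτ hxε
    have hx0 : 0 < τ⁻¹ * u := by positivity
    have hux : u ^ p = τ ^ p * (τ⁻¹ * u) ^ p := by
      rw [← Real.mul_rpow hτ.le hx0.le, mul_inv_cancel_left₀ hτ.ne']
    have hφu : φ (τ⁻¹ * u) / (τ⁻¹ * u) * u = τ * φ (τ⁻¹ * u) := by
      field_simp
    have hne : (((τ⁻¹ * u) ^ p : ℝ) : ℂ) ≠ 0 :=
      Complex.ofReal_ne_zero.2 (Real.rpow_pos_of_pos hx0 p).ne'
    simp only [hg, indicator_of_mem (mem_Iio.2 hxε), Function.comp_apply]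
    rw [hφu, hux, Complex.ofReal_mul, mul_left_comm (_ / _), div_mul_cancel₀ _ hne, mul_assoc]

theorem Real.cos_div_one_sub_sin (θ : ℝ) :
    Real.cos θ / (1 - Real.sin θ) = Real.tan (π / 4 + θ / 2) := by
  have hθ : θ = 2 * (π / 4 + θ / 2) - π / 2 := by ring
  have hc : Real.cos θ = 2 * Real.sin (π / 4 + θ / 2) * Real.cos (π / 4 + θ / 2) := by
    rw [← Real.sin_two_mul, ← Real.cos_sub_pi_div_two, ← hθ]
  have hs : 1 - Real.sin θ = 2 * Real.cos (π / 4 + θ / 2) ^ 2 := by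
    have h2 := Real.cos_two_mul (π / 4 + θ / 2)
    have h3 : Real.sin θ = -Real.cos (2 * (π / 4 + θ / 2)) := by
      rw [← Real.sin_sub_pi_div_two, ← hθ]
    linarith
  rw [hc, hs, Real.tan_eq_sin_div_cos]
  field_simp

theorem Real.tan_sub_tan {a b : ℝ} (ha : Real.cos a ≠ 0) (hb : Real.cos b ≠ 0) :
    Real.tan a - Real.tan b = Real.sin (a - b) / (Real.cos a * Real.cos b) := by
  rw [Real.tan_eq_sin_div_cos, Real.tan_eq_sin_div_cos, Real.sin_sub]
  field_simp

theorem tendsto_two_mul_sin_half_div :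
    Tendsto (fun x : ℝ => 2 * Real.sin (x / 2) / x) (𝓝[>] 0) (𝓝 1) := by
  have h : HasDerivAt (fun x : ℝ => 2 * Real.sin (x / 2)) 1 0 := by
    have := (((hasDerivAt_id (0 : ℝ)).div_const 2).sin).const_mul 2
    simpa using this
  simpa [div_eq_inv_mul] using h.tendsto_slope_zero_right

/-- Watson's lemma step. -/
theorem stmt_3 (s₀ : ℝ) (hs₀ : 0 < s₀) (α : ℝ) (hα : α ∈ Set.Ioo (-(π/2)) (π/2))
    (η' : ℝ) (hη' : 0 < η') (n : ℕ) (hn : 1 ≤ n)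
    (ε' : ℝ) (hε'0 : 0 < ε') (hε' : ε' < π/2 - α)
    (f : ℝ → ℝ)
    (hf : f = fun x => (Real.cos α / (s₀ * (1 + Real.sin α))) *
      (Real.cos (α - x) / (2 * (1 - Real.sin (α - x))))) :
    Tendsto (fun τ : ℝ =>
        ((τ ^ ((n:ℝ) + 1/2) * Real.exp (-τ/(2*s₀)) : ℝ) : ℂ) *
        ∫ x in Set.Ioo (0:ℝ) ε',
          (((2 * Real.sin (x/2)) ^ ((n:ℝ) - 1/2) : ℝ) : ℂ) *
            Complex.exp (Complex.I * ((((n:ℝ) - 1/2) * (α - x/2) : ℝ) : ℂ)) /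
            (((4 * (Real.sin ((π/2 - α + x)/2))^2 : ℝ)) : ℂ) *
            ((Real.exp (τ * f x) : ℝ) : ℂ))
      atTop
      (nhds (Complex.exp (Complex.I * ((((n:ℝ) - 1/2) * α : ℝ) : ℂ)) *
        (((2 * s₀ * Real.cos α) ^ ((n:ℝ) + 1/2) : ℝ) : ℂ) *
        ((Real.Gamma ((n:ℝ) + 1/2) : ℝ) : ℂ) /
        (((2 * (1 - Real.sin α) : ℝ)) : ℂ))) := by
  obtain ⟨hα1, hα2⟩ := hα
  have hcos : 0 < Real.cos α := Real.cos_pos_of_mem_Ioo ⟨hα1, hα2⟩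
  have hsin1 : 0 < 1 + Real.sin α := by
    nlinarith [Real.sin_sq_add_cos_sq α, Real.sin_le_one α, Real.neg_one_le_sin α]
  have hsin2 : 0 < 1 - Real.sin α := by
    nlinarith [Real.sin_sq_add_cos_sq α, Real.sin_le_one α, Real.neg_one_le_sin α]
  have hn' : (1 : ℝ) ≤ n := by exact_mod_cast hn
  set p : ℝ := (n : ℝ) - 1 / 2 with hp
  have hnp : (n : ℝ) + 1 / 2 = p + 1 := by rw [hp]; ring
  set C : ℝ := Real.cos α / (s₀ * (1 + Real.sin α)) with hC
  have hCpos : 0 < C := by positivity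
  have hcospos : ∀ x, 0 ≤ x → x ≤ ε' → 0 < Real.cos (π / 4 + (α - x) / 2) := fun x h0 h1 =>
    Real.cos_pos_of_mem_Ioo ⟨by linarith, by linarith⟩
  have hftan : ∀ x, f x = C / 2 * Real.tan (π / 4 + (α - x) / 2) := by
    intro x
    rw [← Real.cos_div_one_sub_sin, hf]
    simp only [mul_comm (2 : ℝ), ← div_div]
    ring
  have hsq : Real.cos α ^ 2 = (1 + Real.sin α) * (1 - Real.sin α) := by
    nlinarith [Real.sin_sq_add_cos_sq α]
  have hf0 : f 0 = 1 / (2 * s₀) := by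
    rw [hf]
    simp only [sub_zero, hC]
    field_simp
    linarith
  let A : ℝ → ℂ := fun x => (((2 * Real.sin (x/2)) ^ p : ℝ) : ℂ) *
    Complex.exp (Complex.I * ((p * (α - x/2) : ℝ) : ℂ)) /
    (((4 * (Real.sin ((π/2 - α + x)/2))^2 : ℝ)) : ℂ)
  let h : ℝ → ℂ := fun x => Complex.exp (Complex.I * ((p * (α - x/2) : ℝ) : ℂ)) /
    (((4 * (Real.sin ((π/2 - α + x)/2))^2 : ℝ)) : ℂ)
  have hAh : ∀ x, A x = (((2 * Real.sin (x/2)) ^ p : ℝ) : ℂ) * h x := fun x => mul_div_assoc _ _ _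
  have hcont : ContinuousOn h (Icc 0 ε') := by
    refine ContinuousOn.div (by fun_prop) (by fun_prop) fun x hx => ?_
    have : 0 < Real.sin ((π/2 - α + x)/2) :=
      Real.sin_pos_of_pos_of_lt_pi (by linarith [hx.1]) (by linarith [hx.2])
    exact Complex.ofReal_ne_zero.2 (by positivity)
  obtain ⟨M, hM⟩ := isCompact_Icc.exists_bound_of_continuousOn hcont
  have hh0 : Tendsto h (𝓝[>] 0) (𝓝 (h 0)) :=
    ((hcont 0 ⟨le_rfl, hε'0.le⟩).mono_of_mem_nhdsWithin
      (mem_of_superset (Ioo_mem_nhdsGT hε'0) Ioo_subset_Icc_self)).tendsto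
  have hh0val : h 0 = Complex.exp (Complex.I * ((p * α : ℝ) : ℂ)) /
      ((2 * (1 - Real.sin α) : ℝ) : ℂ) := by
    have h4 : 4 * Real.sin ((π/2 - α + 0)/2) ^ 2 = 2 * (1 - Real.sin α) := by
      rw [Real.sin_sq_eq_half_sub, ← Real.cos_pi_div_two_sub α]
      ring_nf
    simp only [h, h4, zero_div, sub_zero]
  have key := tendsto_rpow_mul_integral_mul_exp (p := p) (ε := ε') (M := M) (c := C / (2 * π))
    (k := 1 / (2 * s₀ * Real.cos α)) (A := A) (φ := fun x => f x - 1 / (2 * s₀)) (a := h 0)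
    (by linarith) hε'0 (by positivity) (by positivity) (by fun_prop)
    (by rw [hf]; fun_prop) ?_ ?_ ?_ ?_
  · have hval : h 0 * (((1 / (1 / (2 * s₀ * Real.cos α))) ^ (p + 1) * Real.Gamma (p + 1) : ℝ) : ℂ) =
        Complex.exp (Complex.I * ((p * α : ℝ) : ℂ)) *
        (((2 * s₀ * Real.cos α) ^ (p + 1) : ℝ) : ℂ) * ((Real.Gamma (p + 1) : ℝ) : ℂ) /
        (((2 * (1 - Real.sin α) : ℝ)) : ℂ) := by
      rw [hh0val, one_div_one_div, Complex.ofReal_mul (_ ^ _)]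
      ring
    rw [hval] at key
    rw [hnp]
    refine key.congr fun τ => ?_
    rw [Complex.ofReal_mul, mul_assoc, ← integral_const_mul (Complex.ofReal (Real.exp _))]
    congr 1
    refine integral_congr_ae (Eventually.of_forall fun x => ?_)
    have hexp : Real.exp (τ * (f x - 1 / (2 * s₀))) =
        Real.exp (-τ / (2 * s₀)) * Real.exp (τ * f x) := by
      rw [← Real.exp_add]; ring_nf
    simp only [hexp, A]
    push_cast
    ring
  · intro x hx
    have hs0 : 0 ≤ Real.sin (x / 2) :=
      Real.sin_nonneg_of_nonneg_of_le_pi (by linarith [hx.1]) (by linarith [hx.2])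
    have hs1 : 2 * Real.sin (x / 2) ≤ x := by linarith [Real.sin_le (x := x / 2) (by linarith [hx.1])]
    have hMx := hM x ⟨hx.1.le, hx.2.le⟩
    rw [hAh, norm_mul, Complex.norm_real, Real.norm_of_nonneg (by positivity), mul_comm]
    gcongr
    · exact (norm_nonneg _).trans hMx
    · linarith
  · have h1 := tendsto_two_mul_sin_half_div.rpow_const (p := p) (Or.inl one_ne_zero)
    rw [Real.one_rpow] at h1
    have h2 := ((Complex.continuous_ofReal.tendsto _).comp h1).mul hh0
    rw [Complex.ofReal_one, one_mul] at h2
    refine h2.congr' ?_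
    filter_upwards [Ioo_mem_nhdsGT hε'0] with x hx
    have hs0 : 0 ≤ Real.sin (x / 2) :=
      Real.sin_nonneg_of_nonneg_of_le_pi (by linarith [hx.1]) (by linarith [hx.2])
    rw [hAh, Function.comp_apply, Real.div_rpow (by positivity) hx.1.le, Complex.ofReal_div]
    ring
  · intro x hx
    have hcx := hcospos x hx.1.le hx.2.le
    have hc0 := hcospos 0 le_rfl hε'0.le
    have hs : x / π ≤ Real.sin (x / 2) := by
      have := Real.mul_le_sin (x := x / 2) (by linarith [hx.1]) (by linarith [hx.2])
      calc x / π = 2 / π * (x / 2) := by ring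
        _ ≤ _ := this
    have hsub : f x - f 0 = -(C / 2 * (Real.sin (x / 2) /
        (Real.cos (π / 4 + (α - 0) / 2) * Real.cos (π / 4 + (α - x) / 2)))) := by
      rw [hftan x, hftan 0,
        show x / 2 = π / 4 + (α - 0) / 2 - (π / 4 + (α - x) / 2) by ring,
        ← Real.tan_sub_tan hc0.ne' hcx.ne']
      ring
    have hle : Real.sin (x / 2) ≤ Real.sin (x / 2) /
        (Real.cos (π / 4 + (α - 0) / 2) * Real.cos (π / 4 + (α - x) / 2)) :=
      le_div_self ((div_nonneg hx.1.le pi_pos.le).trans hs) (by positivity)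
        (mul_le_one₀ (Real.cos_le_one _) hcx.le (Real.cos_le_one _))
    rw [← hf0, hsub, neg_le_neg_iff]
    calc C / (2 * π) * x = C / 2 * (x / π) := by field_simp
      _ ≤ _ := by exact mul_le_mul_of_nonneg_left (hs.trans hle) (by positivity)
  · have hs0 : 1 - Real.sin (α - 0) ≠ 0 := by rw [sub_zero]; exact hsin2.ne'
    have hd : HasDerivAt f (-(1 / (2 * s₀ * Real.cos α))) 0 := by
      have hlin : HasDerivAt (fun x : ℝ => α - x) (-1) 0 := by
        simpa using (hasDerivAt_id (0 : ℝ)).const_sub α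
      have := ((hlin.cos).div ((hlin.sin.const_sub 1).const_mul 2)
        (mul_ne_zero two_ne_zero hs0)).const_mul C
      rw [hf]
      refine this.congr_deriv ?_
      simp only [sub_zero, hC]
      field_simp
      nlinarith [Real.sin_sq_add_cos_sq α]
    rw [← hf0]
    simpa [div_eq_inv_mul] using hd.tendsto_slope_zero_right
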